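/- arXiv:1005.3804 — 3 statements merged into one kernel-verified Lean document; each statement's English description precedes it below -/
import Mathlib

section
/- For every s ∈ ℝ \ {0} and x ∈ ℝ^d, the function v is differentiable in s and satisfies ∂v/∂s (s,x) = (i/2) Δv(s,x) + i v(s,x), where Δ denotes the Laplacian in the x-variable. -/
open MeasureTheory Real Set
open scoped Topology

noncomputable section

/-- Directional partial derivative in the `j`-th coordinate direction, complex-valued. -/
def pdC (d : ℕ) (j : Fin d) (g : EuclideanSpace ℝ (Fin d) → ℂ) :
    EuclideanSpace ℝ (Fin d) → ℂ :=
  fun x => fderiv ℝ g x (EuclideanSpace.single j 1)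

/-- Directional partial derivative in the `j`-th coordinate direction, real-valued. -/
def pdR (d : ℕ) (j : Fin d) (g : EuclideanSpace ℝ (Fin d) → ℝ) :
    EuclideanSpace ℝ (Fin d) → ℝ :=
  fun x => fderiv ℝ g x (EuclideanSpace.single j 1)

/-- Laplacian in the space variable. -/
def lapC (d : ℕ) (g : EuclideanSpace ℝ (Fin d) → ℂ) :
    EuclideanSpace ℝ (Fin d) → ℂ :=
  fun x => ∑ j : Fin d, pdC d j (pdC d j g) x

/-- The complex kernel `p_{is}(x,y) = (2πis)^{-d/2} e^{-|x-y|²/(2is)}` (principal branch). -/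
def pk (d : ℕ) (s : ℝ) (x y : EuclideanSpace ℝ (Fin d)) : ℂ :=
  (2 * (Real.pi : ℂ) * Complex.I * (s : ℂ)) ^ (-(d : ℂ) / 2) *
    Complex.exp (-((‖x - y‖ ^ 2 : ℝ) : ℂ) / (2 * Complex.I * (s : ℂ)))

/-- `v(s,x) = e^{is} ∫ f(y) p_{is}(x,y) dy`. -/
def vfun (d : ℕ) (f : EuclideanSpace ℝ (Fin d) → ℝ) (s : ℝ)
    (x : EuclideanSpace ℝ (Fin d)) : ℂ :=
  Complex.exp (Complex.I * (s : ℂ)) * ∫ y, (f y : ℂ) * pk d s x y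

/-- One-dimensional heat kernel `p_t(0,s) = (2πt)^{-1/2} e^{-s²/(2t)}`. -/
def hk (t s : ℝ) : ℝ :=
  (Real.sqrt (2 * Real.pi * t))⁻¹ * Real.exp (-s ^ 2 / (2 * t))

/-- `u(t,x) = ∫_{-∞}^0 v(s,x) p_t(0,s) ds + ∫_0^∞ v(s,x) p_t(0,s) ds`. -/
def ufun (d : ℕ) (f : EuclideanSpace ℝ (Fin d) → ℝ) (t : ℝ)
    (x : EuclideanSpace ℝ (Fin d)) : ℂ :=
  (∫ s in Iio (0 : ℝ), vfun d f s x * (hk t s : ℂ)) +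
    ∫ s in Ioi (0 : ℝ), vfun d f s x * (hk t s : ℂ)

/-- Differentiation under the integral sign against a continuous, compactly supported weight. -/
theorem hasFDerivAt_integral_smul_of_hasCompactSupport {P E F : Type*}
    [NormedAddCommGroup P] [NormedSpace ℝ P] [LocallyCompactSpace P]
    [NormedAddCommGroup E] [SecondCountableTopology E] [MeasurableSpace E] [BorelSpace E]
    [NormedAddCommGroup F] [NormedSpace ℝ F]
    {μ : Measure E} [IsFiniteMeasureOnCompacts μ] {f : E → ℝ} (hf : Continuous f)
    (hsupp : HasCompactSupport f) {K : P → E → F} {K' : P → E → P →L[ℝ] F} {U : Set P} {p₀ : P}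
    (hU : U ∈ 𝓝 p₀) (hK : ∀ p ∈ U, Continuous (K p))
    (hK' : ContinuousOn (fun q : P × E => K' q.1 q.2) (U ×ˢ univ))
    (hd : ∀ p ∈ U, ∀ y, HasFDerivAt (fun p => K p y) (K' p y) p) :
    Integrable (fun y => f y • K' p₀ y) μ ∧
      HasFDerivAt (fun p => ∫ y, f y • K p y ∂μ) (∫ y, f y • K' p₀ y ∂μ) p₀ := by
  obtain ⟨k, hk, hkU, hkc⟩ := local_compact_nhds hU
  obtain ⟨C, hC⟩ := (hkc.prod hsupp.isCompact).exists_bound_of_continuousOn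
    (hK'.mono (prod_mono hkU (subset_univ _)))
  have hfK : ∀ p ∈ U, Integrable (fun y => f y • K p y) μ := fun p hp =>
    (hf.smul (hK p hp)).integrable_of_hasCompactSupport hsupp.smul_right
  have hfK' : Integrable (fun y => f y • K' p₀ y) μ := by
    refine (hf.smul ?_).integrable_of_hasCompactSupport hsupp.smul_right
    exact hK'.comp_continuous (.prodMk_right p₀) fun y => ⟨mem_of_mem_nhds hU, mem_univ y⟩
  refine ⟨hfK', hasFDerivAt_integral_of_dominated_of_fderiv_le (μ := μ)
    (F := fun p y => f y • K p y) (F' := fun p y => f y • K' p y) (bound := fun y => ‖f y‖ * C)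
    hk ?_ (hfK p₀ (mem_of_mem_nhds hU)) hfK'.aestronglyMeasurable ?_
    ((hf.norm.integrable_of_hasCompactSupport hsupp.norm).mul_const C) ?_⟩
  · filter_upwards [hU] with p hp using (hfK p hp).aestronglyMeasurable
  · refine Filter.Eventually.of_forall fun y p hp => ?_
    rw [norm_smul]
    by_cases hy : y ∈ tsupport f
    · exact mul_le_mul_of_nonneg_left (hC (p, y) ⟨hp, hy⟩) (norm_nonneg _)
    · simp [image_eq_zero_of_notMem_tsupport hy]
  · exact Filter.Eventually.of_forall fun y p hp => (hd p (hkU hp) y).const_smul (f y)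

theorem hasFDerivAt_integral_mul_comp_sub {d : ℕ} {f : EuclideanSpace ℝ (Fin d) → ℝ}
    (hf : Continuous f) (hsupp : HasCompactSupport f) {w : EuclideanSpace ℝ (Fin d) → ℂ}
    (hw : ContDiff ℝ 1 w) (x : EuclideanSpace ℝ (Fin d)) :
    Integrable (fun y => f y • fderiv ℝ w (x - y)) ∧
      HasFDerivAt (fun x => ∫ y, (f y : ℂ) * w (x - y)) (∫ y, f y • fderiv ℝ w (x - y)) x := by
  simp only [← Complex.real_smul]
  have hw' := hw.continuous_fderiv one_ne_zero
  have hwc := hw.continuous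
  refine hasFDerivAt_integral_smul_of_hasCompactSupport hf hsupp
    (K := fun x y => w (x - y)) (K' := fun x y => fderiv ℝ w (x - y))
    Filter.univ_mem (fun p _ => by fun_prop) (by fun_prop) fun p _ y => ?_
  exact (hw.differentiable one_ne_zero (p - y)).hasFDerivAt.comp p (hasFDerivAt_sub_const y)

theorem pdC_const_mul_integral {d : ℕ} {f : EuclideanSpace ℝ (Fin d) → ℝ}
    (hf : Continuous f) (hsupp : HasCompactSupport f) {w : EuclideanSpace ℝ (Fin d) → ℂ}
    (hw : ContDiff ℝ 1 w) (c : ℂ) (j : Fin d) :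
    pdC d j (fun x => c * ∫ y, (f y : ℂ) * w (x - y)) =
      fun x => c * ∫ y, (f y : ℂ) * pdC d j w (x - y) := by
  ext x
  obtain ⟨hi, hd⟩ := hasFDerivAt_integral_mul_comp_sub hf hsupp hw x
  rw [pdC, (hd.const_mul c).fderiv, smul_apply,
    ContinuousLinearMap.integral_apply hi]
  simp [pdC]

theorem differentiable_const_mul_integral {d : ℕ} {f : EuclideanSpace ℝ (Fin d) → ℝ}
    (hf : Continuous f) (hsupp : HasCompactSupport f) {w : EuclideanSpace ℝ (Fin d) → ℂ}
    (hw : ContDiff ℝ 1 w) (c : ℂ) :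
    Differentiable ℝ (fun x => c * ∫ y, (f y : ℂ) * w (x - y)) := fun x =>
  ((hasFDerivAt_integral_mul_comp_sub hf hsupp hw x).2.const_mul c).differentiableAt

/-- The complex Gaussian `z ↦ e^{a |z|²}`. -/
def cgauss (d : ℕ) (a : ℂ) (z : EuclideanSpace ℝ (Fin d)) : ℂ :=
  Complex.exp (a * ((‖z‖ ^ 2 : ℝ) : ℂ))

theorem contDiff_cgauss (d : ℕ) (a : ℂ) {n : WithTop ℕ∞} : ContDiff ℝ n (cgauss d a) :=
  (contDiff_const.mul (Complex.ofRealCLM.contDiff.comp (contDiff_norm_sq ℝ))).cexp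

theorem pdC_cgauss {d : ℕ} (a : ℂ) (j : Fin d) :
    pdC d j (cgauss d a) = fun z => 2 * a * (z j : ℂ) * cgauss d a z := by
  ext z
  have h := ((Complex.ofRealCLM.hasFDerivAt.comp z
    (hasStrictFDerivAt_norm_sq z).hasFDerivAt).const_mul a).cexp
  rw [pdC]
  refine (congrArg (fun L => L (EuclideanSpace.single j 1)) h.fderiv).trans ?_
  simp [cgauss, EuclideanSpace.inner_single_right]
  ring

theorem pdC_pdC_cgauss {d : ℕ} (a : ℂ) (j : Fin d) :
    pdC d j (pdC d j (cgauss d a)) =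
      fun z => (2 * a + 4 * a ^ 2 * (z j : ℂ) ^ 2) * cgauss d a z := by
  ext z
  have hg := ((contDiff_cgauss d a (n := 1)).differentiable one_ne_zero z).hasFDerivAt
  have hl : HasFDerivAt (fun z : EuclideanSpace ℝ (Fin d) => 2 * a * (z j : ℂ)) _ z :=
    (Complex.ofRealCLM.hasFDerivAt.comp z
      (EuclideanSpace.proj (𝕜 := ℝ) j).hasFDerivAt).const_mul (2 * a)
  have hv := congrFun (pdC_cgauss a j) z
  rw [pdC] at hv
  rw [pdC_cgauss, pdC, (hl.fun_mul hg).fderiv]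
  simp [hv]
  ring

theorem lapC_cgauss (d : ℕ) (a : ℂ) (z : EuclideanSpace ℝ (Fin d)) :
    lapC d (cgauss d a) z =
      (2 * a * d + 4 * a ^ 2 * ((‖z‖ ^ 2 : ℝ) : ℂ)) * cgauss d a z := by
  simp only [lapC, pdC_pdC_cgauss, EuclideanSpace.real_norm_sq_eq, ← Finset.sum_mul,
    Finset.sum_add_distrib, ← Finset.mul_sum]
  simp only [Finset.sum_const, Finset.card_univ, Fintype.card_fin, nsmul_eq_mul,
    Complex.ofReal_sum, Complex.ofReal_pow]
  ring

theorem contDiff_pdC {d : ℕ} {w : EuclideanSpace ℝ (Fin d) → ℂ} (hw : ContDiff ℝ 2 w)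
    (j : Fin d) : ContDiff ℝ 1 (pdC d j w) :=
  (hw.fderiv_right (m := 1) (by norm_num)).clm_apply contDiff_const

/-- Time derivative of the integral of a compactly supported weight against a complex Gaussian. -/
theorem hasDerivAt_integral_mul_cgauss {d : ℕ} {f : EuclideanSpace ℝ (Fin d) → ℝ}
    (hf : Continuous f) (hsupp : HasCompactSupport f) (x : EuclideanSpace ℝ (Fin d))
    {a a' : ℝ → ℂ} {U : Set ℝ} {s : ℝ} (hU : U ∈ 𝓝 s) (ha : ∀ σ ∈ U, HasDerivAt a (a' σ) σ)
    (ha' : ContinuousOn a' U) :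
    HasDerivAt (fun σ => ∫ y, (f y : ℂ) * cgauss d (a σ) (x - y))
      (∫ y, (f y : ℂ) * (a' s * ((‖x - y‖ ^ 2 : ℝ) : ℂ) * cgauss d (a s) (x - y))) s := by
  simp only [← Complex.real_smul]
  have hac : ContinuousOn a U := fun σ hσ => (ha σ hσ).continuousAt.continuousWithinAt
  have hc1 : ContinuousOn (fun q : ℝ × EuclideanSpace ℝ (Fin d) => a q.1) (U ×ˢ univ) :=
    hac.comp continuousOn_fst fun q hq => hq.1
  have hc2 : ContinuousOn (fun q : ℝ × EuclideanSpace ℝ (Fin d) => a' q.1) (U ×ˢ univ) :=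
    ha'.comp continuousOn_fst fun q hq => hq.1
  obtain ⟨hi, hd⟩ := hasFDerivAt_integral_smul_of_hasCompactSupport (μ := volume) hf hsupp
    (K := fun σ y => cgauss d (a σ) (x - y))
    (K' := fun σ y => ContinuousLinearMap.toSpanSingleton ℝ
      (a' σ * ((‖x - y‖ ^ 2 : ℝ) : ℂ) * cgauss d (a σ) (x - y))) hU
    (fun p _ => by unfold cgauss; fun_prop)
    (by
      refine (ContinuousLinearMap.toSpanSingletonCLE
        (𝕜 := ℝ) (E := ℂ)).continuous.comp_continuousOn ?_
      have hx : ContinuousOn (fun q : ℝ × EuclideanSpace ℝ (Fin d) =>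
          ((‖x - q.2‖ ^ 2 : ℝ) : ℂ)) (U ×ˢ univ) := by fun_prop
      exact (hc2.mul hx).mul (hc1.mul hx).cexp)
    (fun σ hσ y => by
      have h := (((ha σ hσ).mul_const ((‖x - y‖ ^ 2 : ℝ) : ℂ)).cexp).hasFDerivAt
      rw [mul_comm] at h
      exact h)
  have h := hd.hasDerivAt
  rw [ContinuousLinearMap.integral_apply hi] at h
  simpa using h

theorem vfun_eq_cgauss (d : ℕ) (f : EuclideanSpace ℝ (Fin d) → ℝ) (s : ℝ) :
    vfun d f s = fun x => Complex.exp (Complex.I * s) *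
      (2 * (Real.pi : ℂ) * Complex.I * (s : ℂ)) ^ (-(d : ℂ) / 2) *
        ∫ y, (f y : ℂ) * cgauss d (-1 / (2 * Complex.I * s)) (x - y) := by
  ext x
  rw [vfun, ← integral_const_mul, ← integral_const_mul]
  refine integral_congr_ae (.of_forall fun y => ?_)
  beta_reduce
  rw [pk, cgauss, div_mul_eq_mul_div, neg_one_mul]
  ring

/-- for every s ≠ 0 and x, v is differentiable in s and
∂v/∂s = (i/2)Δv + i v (Laplacian in the x-variable). -/
theorem stmt3 (d : ℕ) (hd : 1 ≤ d) (α : ℝ) (hα : α ∈ Set.Ioc (0 : ℝ) 1)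
    (f : EuclideanSpace ℝ (Fin d) → ℝ) (hf : ContDiff ℝ 2 f)
    (hsupp : HasCompactSupport f)
    (hHolder : ∀ i j : Fin d, ∃ C : ℝ, ∀ y z : EuclideanSpace ℝ (Fin d),
      |pdR d i (pdR d j f) y - pdR d i (pdR d j f) z| ≤ C * ‖y - z‖ ^ α) :
    ∀ s : ℝ, s ≠ 0 → ∀ x : EuclideanSpace ℝ (Fin d),
      Differentiable ℝ (vfun d f s) ∧
      (∀ j : Fin d, Differentiable ℝ (pdC d j (vfun d f s))) ∧
      HasDerivAt (fun σ => vfun d f σ x)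
        ((Complex.I / 2) * lapC d (vfun d f s) x + Complex.I * vfun d f s x) s := by
  intro s hs x
  have hfc := hf.continuous
  set a : ℝ → ℂ := fun σ => -1 / (2 * Complex.I * σ) with ha_def
  have hg : ContDiff ℝ 2 (cgauss d (a s)) := contDiff_cgauss d _
  have hg1 : ContDiff ℝ 1 (cgauss d (a s)) := contDiff_cgauss d _
  have hsC : (s : ℂ) ≠ 0 := Complex.ofReal_ne_zero.2 hs
  have hI2 := Complex.I_sq
  have hvs : vfun d f s = fun x => Complex.exp (Complex.I * s) *
      (2 * (Real.pi : ℂ) * Complex.I * (s : ℂ)) ^ (-(d : ℂ) / 2) *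
        ∫ y, (f y : ℂ) * cgauss d (a s) (x - y) := vfun_eq_cgauss d f s
  refine ⟨?_, fun j => ?_, ?_⟩
  · rw [hvs]
    exact differentiable_const_mul_integral hfc hsupp hg1 _
  · rw [hvs, pdC_const_mul_integral hfc hsupp hg1]
    exact differentiable_const_mul_integral hfc hsupp (contDiff_pdC hg j) _
  have hfw : ∀ w : EuclideanSpace ℝ (Fin d) → ℂ, Continuous w →
      Integrable (fun y => (f y : ℂ) * w (x - y)) := fun w hw => by
    simp only [← Complex.real_smul]
    exact (hfc.smul (by fun_prop)).integrable_of_hasCompactSupport hsupp.smul_right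
  have hlap : lapC d (vfun d f s) x = Complex.exp (Complex.I * s) *
      (2 * (Real.pi : ℂ) * Complex.I * (s : ℂ)) ^ (-(d : ℂ) / 2) *
        ∫ y, (f y : ℂ) * lapC d (cgauss d (a s)) (x - y) := by
    simp only [lapC, hvs, pdC_const_mul_integral hfc hsupp hg1,
      pdC_const_mul_integral hfc hsupp (contDiff_pdC hg _), Finset.mul_sum]
    rw [integral_finsetSum _ fun j _ => hfw _ ?_, Finset.mul_sum]
    rw [pdC_pdC_cgauss]
    unfold cgauss
    fun_prop
  have hda : ∀ σ ∈ ({0}ᶜ : Set ℝ), HasDerivAt a (1 / (2 * Complex.I * (σ : ℂ) ^ 2)) σ := by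
    intro σ hσ
    have hσ' : (σ : ℂ) ≠ 0 := Complex.ofReal_ne_zero.2 hσ
    have h := (((hasDerivAt_id (σ : ℂ)).const_mul (2 * Complex.I)).fun_inv
      (by simpa using hσ')).const_mul (-1) |>.comp_ofReal
    simp only [id] at h
    have hI := Complex.I_ne_zero
    have ha : a = fun y : ℝ => -1 * (2 * Complex.I * (y : ℂ))⁻¹ := by
      ext y
      exact div_eq_mul_inv _ _
    rw [ha]
    refine h.congr_deriv ?_
    field_simp
  have hdI := hasDerivAt_integral_mul_cgauss hfc hsupp x (isOpen_compl_singleton.mem_nhds hs)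
    hda (by
      refine ContinuousOn.div (by fun_prop) (by fun_prop) fun σ hσ => ?_
      simpa using hσ)
  have hdc : HasDerivAt (fun σ : ℝ => (2 * (Real.pi : ℂ) * Complex.I * (σ : ℂ)) ^ (-(d : ℂ) / 2))
      (-(d : ℂ) / (2 * s) * (2 * (Real.pi : ℂ) * Complex.I * (s : ℂ)) ^ (-(d : ℂ) / 2)) s := by
    have hslit : 2 * (Real.pi : ℂ) * Complex.I * (s : ℂ) ∈ Complex.slitPlane := by
      refine Or.inr ?_
      simp [Real.pi_ne_zero, hs]
    have h := (((hasDerivAt_id (s : ℂ)).const_mul (2 * (Real.pi : ℂ) * Complex.I)).cpow_const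
      (c := -(d : ℂ) / 2) hslit).comp_ofReal
    refine h.congr_deriv ?_
    simp only [id]
    rw [Complex.cpow_sub _ _ (Complex.slitPlane_ne_zero hslit), Complex.cpow_one]
    have := Complex.I_ne_zero
    have : (Real.pi : ℂ) ≠ 0 := Complex.ofReal_ne_zero.2 Real.pi_ne_zero
    field_simp
  have hde : HasDerivAt (fun σ : ℝ => Complex.exp (Complex.I * σ))
      (Complex.I * Complex.exp (Complex.I * s)) s := by
    have h := (((hasDerivAt_id (s : ℂ)).const_mul Complex.I).cexp).comp_ofReal
    simpa [mul_comm] using h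
  have hsplit : ∫ y, (f y : ℂ) * lapC d (cgauss d (a s)) (x - y) =
      2 * a s * d * (∫ y, (f y : ℂ) * cgauss d (a s) (x - y)) + 4 * a s ^ 2 *
        (2 * Complex.I * s ^ 2) * ∫ y, (f y : ℂ) *
          (1 / (2 * Complex.I * (s : ℂ) ^ 2) * ((‖x - y‖ ^ 2 : ℝ) : ℂ) *
            cgauss d (a s) (x - y)) := by
    rw [← integral_const_mul, ← integral_const_mul, ← integral_add]
    · congr 1
      ext y
      rw [lapC_cgauss]
      have := Complex.I_ne_zero
      field_simp
    · exact (hfw _ hg.continuous).const_mul _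
    · refine (hfw (fun z => 1 / (2 * Complex.I * (s : ℂ) ^ 2) * ((‖z‖ ^ 2 : ℝ) : ℂ) *
        cgauss d (a s) z) ?_).const_mul _
      unfold cgauss
      fun_prop
  have hv : (fun σ => vfun d f σ x) = fun σ : ℝ => Complex.exp (Complex.I * σ) *
      (2 * (Real.pi : ℂ) * Complex.I * (σ : ℂ)) ^ (-(d : ℂ) / 2) *
        ∫ y, (f y : ℂ) * cgauss d (a σ) (x - y) := by
    ext σ
    rw [vfun_eq_cgauss]
  rw [hv, hlap, hsplit, hvs]
  refine ((hde.fun_mul hdc).fun_mul hdI).congr_deriv ?_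
  have hI := Complex.I_ne_zero
  have ha1 : 2 * a s = Complex.I / s := by
    simp only [ha_def]
    field_simp
    rw [hI2]
  have ha2 : 4 * a s ^ 2 * (2 * Complex.I * s ^ 2) = -2 * Complex.I := by
    rw [show 4 * a s ^ 2 = (2 * a s) ^ 2 by ring, ha1]
    field_simp
    rw [hI2]
  beta_reduce
  rw [ha2, ha1]
  generalize ∫ y, (f y : ℂ) * cgauss d (a s) (x - y) = A
  generalize ∫ y, (f y : ℂ) * (1 / (2 * Complex.I * (s : ℂ) ^ 2) * ((‖x - y‖ ^ 2 : ℝ) : ℂ) *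
    cgauss d (a s) (x - y)) = B
  linear_combination (-(Complex.exp (Complex.I * s) *
    (2 * (Real.pi : ℂ) * Complex.I * (s : ℂ)) ^ (-(d : ℂ) / 2) * (d / (2 * s) * A - B))) * hI2

end
end

section
/- For every s ∈ ℝ \ {0} and x ∈ ℝ^d, the function v is twice differentiable in s and satisfies ∂²v/∂s² (s,x) = −(1/4) Δ²v(s,x) − Δv(s,x) − v(s,x), where Δ denotes the Laplacian and Δ² the bilaplacian in the x-variable. -/
open MeasureTheory Real Set
open scoped Topology

noncomputable section

theorem HasCompactSupport.integrable_smul_of_continuous {Y V : Type*}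
    [TopologicalSpace Y] [SecondCountableTopology Y] [MeasurableSpace Y] [BorelSpace Y]
    {μ : Measure Y} [IsFiniteMeasureOnCompacts μ] [NormedAddCommGroup V] [NormedSpace ℂ V]
    {f : Y → ℂ} (hsupp : HasCompactSupport f) (hf : Continuous f) {g : Y → V}
    (hg : Continuous g) : Integrable (fun y => f y • g y) μ := by
  refine (hf.smul hg).integrable_of_hasCompactSupport (hsupp.mono fun y hy h0 => hy ?_)
  simp [h0]

theorem HasCompactSupport.hasFDerivAt_integral_mul {H Y : Type*}
    [NormedAddCommGroup H] [NormedSpace ℝ H] [FiniteDimensional ℝ H]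
    [TopologicalSpace Y] [SecondCountableTopology Y] [MeasurableSpace Y] [BorelSpace Y]
    {μ : Measure Y} [IsFiniteMeasureOnCompacts μ]
    {f : Y → ℂ} (hsupp : HasCompactSupport f) (hf : Continuous f)
    {K : H → Y → ℂ} {K' : H → Y → H →L[ℝ] ℂ}
    (hK : ∀ x, Continuous (K x)) (hK' : Continuous fun p : H × Y => K' p.1 p.2)
    (hderiv : ∀ x y, HasFDerivAt (fun x => K x y) (K' x y) x) (x₀ : H) :
    HasFDerivAt (fun x => ∫ y, f y * K x y ∂μ) (∫ y, f y • K' x₀ y ∂μ) x₀ := by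
  have : ProperSpace H := FiniteDimensional.proper ℝ H
  obtain ⟨C, hC⟩ := ((isCompact_closedBall x₀ 1).prod hsupp).exists_bound_of_continuousOn
    hK'.continuousOn
  have hint : ∀ x, Integrable (fun y => f y * K x y) μ := fun x =>
    hsupp.integrable_smul_of_continuous hf (hK x)
  have hint' : Integrable (fun y => f y • K' x₀ y) μ :=
    hsupp.integrable_smul_of_continuous hf (hK'.comp (Continuous.prodMk_right x₀))
  have hmul (y : Y) (x : H) : HasFDerivAt (fun x => f y * K x y) (f y • K' x y) x :=
    (hderiv x y).const_mul (f y)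
  have hbound (y : Y) (x : H) (hx : x ∈ Metric.closedBall x₀ 1) : ‖f y • K' x y‖ ≤ ‖f y‖ * C := by
    rw [norm_smul]
    by_cases hy : y ∈ tsupport f
    · exact mul_le_mul_of_nonneg_left (hC (x, y) ⟨hx, hy⟩) (norm_nonneg _)
    · simp [image_eq_zero_of_notMem_tsupport hy]
  have hbound_int : Integrable (fun y => ‖f y‖ * C) μ :=
    (hf.integrable_of_hasCompactSupport hsupp).norm.mul_const C
  exact hasFDerivAt_integral_of_dominated_of_fderiv_le
    (Metric.closedBall_mem_nhds x₀ one_pos)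
    (.of_forall fun x => (hint x).aestronglyMeasurable) (hint x₀)
    hint'.aestronglyMeasurable (.of_forall hbound) hbound_int (.of_forall fun y x _ => hmul y x)

theorem pdC_integral_mul {d : ℕ} (j : Fin d) {f : EuclideanSpace ℝ (Fin d) → ℂ}
    (hsupp : HasCompactSupport f) (hf : Continuous f)
    {K : EuclideanSpace ℝ (Fin d) → EuclideanSpace ℝ (Fin d) → ℂ}
    {K' : EuclideanSpace ℝ (Fin d) → EuclideanSpace ℝ (Fin d) →
      EuclideanSpace ℝ (Fin d) →L[ℝ] ℂ}
    (hK : ∀ x, Continuous (K x))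
    (hK' : Continuous fun p : EuclideanSpace ℝ (Fin d) × EuclideanSpace ℝ (Fin d) => K' p.1 p.2)
    (hderiv : ∀ x y, HasFDerivAt (fun x => K x y) (K' x y) x) :
    pdC d j (fun x => ∫ y, f y * K x y) =
      fun x => ∫ y, f y * K' x y (EuclideanSpace.single j 1) := by
  funext x
  have hint : Integrable fun y => f y • K' x y :=
    hsupp.integrable_smul_of_continuous hf (hK'.comp (Continuous.prodMk_right x))
  rw [pdC, (hsupp.hasFDerivAt_integral_mul hf hK hK' hderiv x).fderiv,
    ContinuousLinearMap.integral_apply hint]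
  simp

theorem hasFDerivAt_comp_norm_sub_sq {E : Type*} [NormedAddCommGroup E] [InnerProductSpace ℝ E]
    {g g' : ℝ → ℂ} (hg : ∀ ρ, HasDerivAt g (g' ρ) ρ) (x y : E) :
    HasFDerivAt (fun x => g (‖x - y‖ ^ 2))
      ((2 • innerSL ℝ (x - y)).smulRight (g' (‖x - y‖ ^ 2))) x := by
  have h := ((hg (‖x - y‖ ^ 2)).hasFDerivAt).comp x ((hasFDerivAt_id x).sub_const y).norm_sq
  refine h.congr_fderiv ?_
  ext z
  simp
  ring

/-- The Laplacian of a convolution with a radial kernel `g (‖x - y‖²)`. -/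
theorem lapC_integral_radial {d : ℕ} {f : EuclideanSpace ℝ (Fin d) → ℂ}
    (hsupp : HasCompactSupport f) (hf : Continuous f) {g g' g'' : ℝ → ℂ}
    (hg : ∀ ρ, HasDerivAt g (g' ρ) ρ) (hg' : ∀ ρ, HasDerivAt g' (g'' ρ) ρ)
    (hg'' : Continuous g'') :
    lapC d (fun x => ∫ y, f y * g (‖x - y‖ ^ 2)) =
      fun x => ∫ y, f y * (2 * d * g' (‖x - y‖ ^ 2)
        + 4 * (‖x - y‖ ^ 2 : ℝ) * g'' (‖x - y‖ ^ 2)) := by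
  have cg : Continuous g := continuous_iff_continuousAt.2 fun ρ => (hg ρ).continuousAt
  have cg' : Continuous g' := continuous_iff_continuousAt.2 fun ρ => (hg' ρ).continuousAt
  have first (j : Fin d) : pdC d j (fun x => ∫ y, f y * g (‖x - y‖ ^ 2)) =
      fun x => ∫ y, f y * ((2 * (x j - y j) : ℝ) • g' (‖x - y‖ ^ 2)) := by
    rw [pdC_integral_mul j hsupp hf (fun x => by fun_prop) ?_
      fun x y => hasFDerivAt_comp_norm_sub_sq hg x y]
    · funext x
      congr 1; funext y
      simp [EuclideanSpace.inner_single_right]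
    · exact continuous_clm_apply.2 fun z => by simp; fun_prop
  have second (j : Fin d) :
      pdC d j (fun x => ∫ y, f y * ((2 * (x j - y j) : ℝ) • g' (‖x - y‖ ^ 2))) =
      fun x => ∫ y, f y * (2 * g' (‖x - y‖ ^ 2)
        + 4 * ((x j - y j) ^ 2 : ℝ) * g'' (‖x - y‖ ^ 2)) := by
    have hlin (x y : EuclideanSpace ℝ (Fin d)) :
        HasFDerivAt (fun x : EuclideanSpace ℝ (Fin d) => 2 * (x j - y j))
          ((2 : ℝ) • (EuclideanSpace.proj j : EuclideanSpace ℝ (Fin d) →L[ℝ] ℝ)) x :=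
      ((EuclideanSpace.proj j : EuclideanSpace ℝ (Fin d) →L[ℝ] ℝ).hasFDerivAt.sub_const
        (y j)).const_mul 2
    rw [pdC_integral_mul j hsupp hf (fun x => by fun_prop) ?_
      fun x y => (hlin x y).fun_smul (hasFDerivAt_comp_norm_sub_sq hg' x y)]
    · funext x
      congr 1; funext y
      simp [EuclideanSpace.inner_single_right]
      left; ring
    · exact continuous_clm_apply.2 fun z => by simp; fun_prop
  funext x
  simp only [lapC, first, second]
  rw [← integral_finsetSum]
  · congr 1; funext y
    rw [EuclideanSpace.real_norm_sq_eq (x - y)]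
    simp only [← Finset.mul_sum, Finset.sum_add_distrib, ← Finset.sum_mul, PiLp.sub_apply]
    push_cast
    simp
    left; ring
  · intro j _
    exact Continuous.integrable_of_hasCompactSupport (by fun_prop) hsupp.mul_right

/-- The oscillatory moment `∫ f(y) |x-y|^{2k} e^{ib|x-y|²} dy`. -/
def oscMoment {d : ℕ} (f : EuclideanSpace ℝ (Fin d) → ℂ) (k : ℕ) (b : ℝ)
    (x : EuclideanSpace ℝ (Fin d)) : ℂ :=
  ∫ y, f y * ((‖x - y‖ ^ 2 : ℝ) ^ k * Complex.exp (Complex.I * b * (‖x - y‖ ^ 2 : ℝ)))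

theorem hasDerivAt_oscMoment {d : ℕ} {f : EuclideanSpace ℝ (Fin d) → ℂ}
    (hsupp : HasCompactSupport f) (hf : Continuous f) (k : ℕ) (b : ℝ)
    (x : EuclideanSpace ℝ (Fin d)) :
    HasDerivAt (fun b => oscMoment f k b x) (Complex.I * oscMoment f (k + 1) b x) b := by
  have hexp (b : ℝ) (y : EuclideanSpace ℝ (Fin d)) :
      HasDerivAt (fun b : ℝ => ((‖x - y‖ ^ 2 : ℝ) : ℂ) ^ k *
          Complex.exp (Complex.I * b * (‖x - y‖ ^ 2 : ℝ)))
        (Complex.I * (((‖x - y‖ ^ 2 : ℝ) : ℂ) ^ (k + 1) *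
          Complex.exp (Complex.I * b * (‖x - y‖ ^ 2 : ℝ)))) b := by
    have h := (((((hasDerivAt_id b).ofReal_comp).const_mul Complex.I).mul_const
      ((‖x - y‖ ^ 2 : ℝ) : ℂ)).cexp).const_mul (((‖x - y‖ ^ 2 : ℝ) : ℂ) ^ k)
    refine h.congr_deriv ?_
    simp only [id]
    push_cast
    ring
  have h := (hsupp.hasFDerivAt_integral_mul hf (μ := volume) (fun b => by fun_prop)
    (continuous_clm_apply.2 fun z => by simp; fun_prop) (fun b y => (hexp b y).hasFDerivAt) b).hasDerivAt
  refine h.congr_deriv ?_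
  rw [ContinuousLinearMap.integral_apply]
  · simp [oscMoment]
    rw [← integral_const_mul]
    congr 1; funext y; ring
  · exact hsupp.integrable_smul_of_continuous hf
      (continuous_clm_apply.2 fun z => by simp; fun_prop)

theorem integral_mul_quadratic_exp {d : ℕ} {f : EuclideanSpace ℝ (Fin d) → ℂ}
    (hsupp : HasCompactSupport f) (hf : Continuous f) (c₀ c₁ c₂ : ℂ) (b : ℝ)
    (x : EuclideanSpace ℝ (Fin d)) :
    ∫ y, f y * ((c₀ + c₁ * (‖x - y‖ ^ 2 : ℝ) + c₂ * (‖x - y‖ ^ 2 : ℝ) ^ 2) *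
        Complex.exp (Complex.I * b * (‖x - y‖ ^ 2 : ℝ))) =
      c₀ * oscMoment f 0 b x + c₁ * oscMoment f 1 b x + c₂ * oscMoment f 2 b x := by
  have hint (k : ℕ) : Integrable fun y : EuclideanSpace ℝ (Fin d) => f y * ((‖x - y‖ ^ 2 : ℝ) ^ k *
      Complex.exp (Complex.I * b * (‖x - y‖ ^ 2 : ℝ))) :=
    Continuous.integrable_of_hasCompactSupport (by fun_prop) hsupp.mul_right
  simp only [oscMoment, ← integral_const_mul]
  rw [← integral_add ((hint 0).const_mul _) ((hint 1).const_mul _)]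
  refine Eq.trans ?_
    (integral_add (((hint 0).const_mul c₀).add ((hint 1).const_mul c₁)) ((hint 2).const_mul c₂))
  congr 1; funext y
  ring

theorem lapC_linear_exp {d : ℕ} {f : EuclideanSpace ℝ (Fin d) → ℂ}
    (hsupp : HasCompactSupport f) (hf : Continuous f) (c₀ c₁ : ℂ) (b : ℝ) :
    lapC d (fun x => ∫ y, f y * ((c₀ + c₁ * (‖x - y‖ ^ 2 : ℝ)) *
        Complex.exp (Complex.I * b * (‖x - y‖ ^ 2 : ℝ)))) =
      fun x => ∫ y, f y * ((2 * d * (Complex.I * b * c₀ + c₁)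
        + (2 * d * (Complex.I * b) * c₁ + 4 * ((Complex.I * b) ^ 2 * c₀ + 2 * (Complex.I * b) * c₁))
          * (‖x - y‖ ^ 2 : ℝ)
        + 4 * (Complex.I * b) ^ 2 * c₁ * (‖x - y‖ ^ 2 : ℝ) ^ 2) *
        Complex.exp (Complex.I * b * (‖x - y‖ ^ 2 : ℝ))) := by
  have hder (c₀ c₁ : ℂ) (ρ : ℝ) :
      HasDerivAt (fun ρ : ℝ => (c₀ + c₁ * ρ) * Complex.exp (Complex.I * b * ρ))
        ((Complex.I * b * c₀ + c₁ + Complex.I * b * c₁ * ρ) * Complex.exp (Complex.I * b * ρ))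
        ρ := by
    have hid := (hasDerivAt_id ρ).ofReal_comp
    refine (((hid.const_mul c₁).const_add c₀).mul
      (hid.const_mul (Complex.I * b)).cexp).congr_deriv ?_
    simp only [id]
    push_cast
    ring
  rw [lapC_integral_radial hsupp hf (hder c₀ c₁) (hder _ _) (by fun_prop)]
  funext x
  congr 1; funext y
  ring

/-- The factor of `vfun` that does not depend on the space variable. -/
def vfactor (d : ℕ) (s : ℝ) : ℂ :=
  Complex.exp (Complex.I * s) * (2 * (Real.pi : ℂ) * Complex.I * (s : ℂ)) ^ (-(d : ℂ) / 2)

theorem hasDerivAt_vfactor (d : ℕ) {s : ℝ} (hs : s ≠ 0) :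
    HasDerivAt (vfactor d) ((Complex.I - d / (2 * s)) * vfactor d s) s := by
  have hid := (hasDerivAt_id s).ofReal_comp
  have hsc : (s : ℂ) ≠ 0 := by exact_mod_cast hs
  have hpi : (Real.pi : ℂ) ≠ 0 := by exact_mod_cast Real.pi_ne_zero
  have hbase : 2 * (Real.pi : ℂ) * Complex.I * (s : ℂ) ≠ 0 := by
    simp [hsc, hpi]
  have hslit : 2 * (Real.pi : ℂ) * Complex.I * (s : ℂ) ∈ Complex.slitPlane := by
    right
    simp [hs, Real.pi_ne_zero]
  have hpow := (((hasDerivAt_id (s : ℂ)).const_mul (2 * (Real.pi : ℂ) * Complex.I)).cpow_const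
    (c := -(d : ℂ) / 2) hslit).comp_ofReal
  refine ((hid.const_mul Complex.I).cexp.mul hpow).congr_deriv ?_
  simp only [id, vfactor, Complex.cpow_sub _ _ hbase, Complex.cpow_one]
  field_simp
  push_cast
  ring

theorem vfun_eq_integral (d : ℕ) (f : EuclideanSpace ℝ (Fin d) → ℝ) (s : ℝ) :
    vfun d f s = fun x => ∫ y, (f y : ℂ) * ((vfactor d s + 0 * (‖x - y‖ ^ 2 : ℝ)) *
      Complex.exp (Complex.I * ((2 * s)⁻¹ : ℝ) * (‖x - y‖ ^ 2 : ℝ))) := by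
  funext x
  rw [vfun, ← integral_const_mul]
  congr 1; funext y
  have : -((‖x - y‖ ^ 2 : ℝ) : ℂ) / (2 * Complex.I * s) =
      Complex.I * ((2 * s)⁻¹ : ℝ) * (‖x - y‖ ^ 2 : ℝ) := by
    push_cast
    rw [div_eq_mul_inv, mul_inv, mul_inv, Complex.inv_I, mul_inv]
    ring
  rw [pk, vfactor, this]
  ring

/-- for every s ≠ 0 and x, v is twice differentiable in s and
∂²v/∂s² = -(1/4)Δ²v - Δv - v (Laplacian/bilaplacian in the x-variable). -/
theorem stmt4 (d : ℕ) (hd : 1 ≤ d) (α : ℝ) (hα : α ∈ Set.Ioc (0 : ℝ) 1)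
    (f : EuclideanSpace ℝ (Fin d) → ℝ) (hf : ContDiff ℝ 2 f)
    (hsupp : HasCompactSupport f)
    (hHolder : ∀ i j : Fin d, ∃ C : ℝ, ∀ y z : EuclideanSpace ℝ (Fin d),
      |pdR d i (pdR d j f) y - pdR d i (pdR d j f) z| ≤ C * ‖y - z‖ ^ α) :
    ∀ s : ℝ, s ≠ 0 → ∀ x : EuclideanSpace ℝ (Fin d),
      (∀ σ : ℝ, σ ≠ 0 → DifferentiableAt ℝ (fun τ => vfun d f τ x) σ) ∧
      HasDerivAt (deriv (fun τ => vfun d f τ x))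
        (-(1 / 4 : ℂ) * lapC d (lapC d (vfun d f s)) x
          - lapC d (vfun d f s) x - vfun d f s x) s := by
  intro s hs x
  set F : EuclideanSpace ℝ (Fin d) → ℂ := fun y => (f y : ℂ) with hF
  have hFc : Continuous F := Complex.continuous_ofReal.comp hf.continuous
  have hFs : HasCompactSupport F := hsupp.comp_left Complex.ofReal_zero
  set M : ℕ → ℝ → ℂ := fun k σ => oscMoment F k (2 * σ)⁻¹ x with hM
  have hMd (k : ℕ) {σ : ℝ} (hσ : σ ≠ 0) :
      HasDerivAt (M k) (-Complex.I / (2 * σ ^ 2) * M (k + 1) σ) σ := by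
    have hb : HasDerivAt (fun σ : ℝ => (2 * σ)⁻¹) (-(2 * σ ^ 2)⁻¹) σ := by
      refine (((hasDerivAt_id σ).const_mul 2).inv (by simpa using hσ)).congr_deriv ?_
      simp only [id]
      field_simp
    refine ((hasDerivAt_oscMoment hFs hFc k (2 * σ)⁻¹ x).scomp σ hb).congr_deriv ?_
    simp only [hM, Complex.real_smul]
    push_cast
    ring
  have hv (σ : ℝ) : vfun d f σ x = vfactor d σ * M 0 σ := by
    have := integral_mul_quadratic_exp hFs hFc (vfactor d σ) 0 0 (2 * σ)⁻¹ x
    simpa [vfun_eq_integral, hM, hF] using this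
  have hv' {σ : ℝ} (hσ : σ ≠ 0) : HasDerivAt (fun τ => vfun d f τ x)
      (vfactor d σ * ((Complex.I - d / (2 * σ)) * M 0 σ
        + -Complex.I / (2 * σ ^ 2) * M 1 σ)) σ := by
    simp only [hv]
    refine ((hasDerivAt_vfactor d hσ).mul (hMd 0 hσ)).congr_deriv ?_
    ring
  refine ⟨fun σ hσ => (hv' hσ).differentiableAt, ?_⟩
  have hsc : (s : ℂ) ≠ 0 := by exact_mod_cast hs
  have hev : deriv (fun τ => vfun d f τ x) =ᶠ[𝓝 s] fun σ =>
      vfactor d σ * ((Complex.I - d / (2 * σ)) * M 0 σ + -Complex.I / (2 * σ ^ 2) * M 1 σ) := by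
    filter_upwards [isOpen_ne.mem_nhds hs] with σ hσ using (hv' hσ).deriv
  refine HasDerivAt.congr_of_eventuallyEq ?_ hev
  have hid := (hasDerivAt_id s).ofReal_comp
  have hcoef₀ : HasDerivAt (fun σ : ℝ => Complex.I - d / (2 * σ)) ((d : ℂ) / (2 * s ^ 2)) s := by
    refine (((hasDerivAt_const s (d : ℂ)).div (hid.const_mul 2)
      (by simpa using hsc)).const_sub Complex.I).congr_deriv ?_
    simp only [id]
    field_simp
    push_cast
    ring
  have hcoef₁ : HasDerivAt (fun σ : ℝ => -Complex.I / (2 * (σ : ℂ) ^ 2)) (Complex.I / s ^ 3) s := by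
    refine ((hasDerivAt_const s (-Complex.I)).div ((hid.fun_pow 2).const_mul 2)
      (by simpa using hsc)).congr_deriv ?_
    simp only [id]
    field_simp
    push_cast
    ring
  have hlap : lapC d (vfun d f s) = fun x => ∫ y, F y *
      ((2 * d * (Complex.I * (2 * s)⁻¹) * vfactor d s
        + 4 * (Complex.I * (2 * s)⁻¹) ^ 2 * vfactor d s * (‖x - y‖ ^ 2 : ℝ)) *
        Complex.exp (Complex.I * ((2 * s)⁻¹ : ℝ) * (‖x - y‖ ^ 2 : ℝ))) := by
    rw [vfun_eq_integral, lapC_linear_exp hFs hFc]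
    funext x
    congr 1; funext y
    push_cast
    ring
  have hlapx : lapC d (vfun d f s) x = 2 * d * (Complex.I * (2 * s)⁻¹) * vfactor d s * M 0 s
      + 4 * (Complex.I * (2 * s)⁻¹) ^ 2 * vfactor d s * M 1 s := by
    have h := integral_mul_quadratic_exp hFs hFc (2 * d * (Complex.I * (2 * s)⁻¹) * vfactor d s)
      (4 * (Complex.I * (2 * s)⁻¹) ^ 2 * vfactor d s) 0 (2 * s)⁻¹ x
    simp only [zero_mul, add_zero] at h
    exact (congrFun hlap x).trans h
  have hlap₂ := (congrFun ((congrArg (lapC d) hlap).trans (lapC_linear_exp hFs hFc _ _ _)) x).trans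
    (integral_mul_quadratic_exp hFs hFc _ _ _ _ x)
  refine ((hasDerivAt_vfactor d hs).mul
    ((hcoef₀.mul (hMd 0 hs)).add (hcoef₁.mul (hMd 1 hs)))).congr_deriv ?_
  rw [hlap₂, hlapx, hv s]
  simp only [hM, Pi.add_apply, Pi.mul_apply]
  push_cast
  field_simp
  ring_nf
  simp only [Complex.I_sq, Complex.I_pow_three, Complex.I_pow_four]
  ring

end
end

section
/- For every s ∈ ℝ \ {0}, every x ∈ ℝ^d, and every coordinate index j ∈ {1,…,d}, the fourth partial derivative of v in x_j exists and satisfies ∂⁴v/∂x_j⁴ (s,x) = e^{is} ∫_{ℝ^d} (∂²f/∂y_j²)(y) · (∂²/∂y_j²) p_{is}(x,y) dy; that is, two of the four x_j-derivatives of the kernel can be transferred onto f by integration by parts. -/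
open MeasureTheory Real Set
open scoped Topology

noncomputable section

open scoped ContDiff

/-- The coordinate derivative of a smooth function is smooth. -/
theorem ContDiff.pdC {d : ℕ} {K : EuclideanSpace ℝ (Fin d) → ℂ} (hK : ContDiff ℝ ∞ K)
    (j : Fin d) : ContDiff ℝ ∞ (pdC d j K) :=
  (hK.fderiv_right (m := ∞) (by simp)).clm_apply contDiff_const

theorem pdC_ofReal {d : ℕ} (j : Fin d) {g : EuclideanSpace ℝ (Fin d) → ℝ}
    (hg : Differentiable ℝ g) :
    pdC d j (fun y => (g y : ℂ)) = fun y => (pdR d j g y : ℂ) := by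
  funext y
  have h : HasFDerivAt (fun y => (g y : ℂ)) (Complex.ofRealCLM.comp (fderiv ℝ g y)) y :=
    Complex.ofRealCLM.hasFDerivAt.comp y (hg y).hasFDerivAt
  simp [pdC, pdR, h.fderiv]

theorem pdC_neg {d : ℕ} (j : Fin d) (g : EuclideanSpace ℝ (Fin d) → ℂ)
    (y : EuclideanSpace ℝ (Fin d)) : pdC d j (fun y => -g y) y = -pdC d j g y := by
  simp [pdC, fderiv_fun_neg]

theorem pdC_comp_const_sub {d : ℕ} (j : Fin d) (x : EuclideanSpace ℝ (Fin d))
    (g : EuclideanSpace ℝ (Fin d) → ℂ) :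
    pdC d j (fun y => g (x - y)) = fun y => -pdC d j g (x - y) := by
  funext y
  have h : fderiv ℝ (fun y => g (x - y)) y = -fderiv ℝ g (x - y) := by
    have h1 := (LinearIsometryEquiv.neg ℝ (E := EuclideanSpace ℝ (Fin d))
      ).toContinuousLinearEquiv.comp_right_fderiv (f := fun z => g (x + z)) (x := y)
    rw [fderiv_comp_add_left] at h1
    ext v
    simpa [Function.comp_def, sub_eq_add_neg] using congrArg (fun L => L v) h1
  simp [pdC, h]

theorem contDiff_pk_left (d : ℕ) (s : ℝ) : ContDiff ℝ ∞ (fun z => pk d s z 0) := by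
  unfold pk
  refine contDiff_const.mul (ContDiff.cexp (ContDiff.div_const (ContDiff.neg ?_) _))
  exact Complex.ofRealCLM.contDiff.comp ((contDiff_id.sub contDiff_const).norm_sq ℝ)

/-- Differentiation under the integral sign for the convolution of a compactly supported
continuous function with a `C¹` kernel. -/
theorem differentiable_convolution_and_pdC_eq {d : ℕ} (j : Fin d) (a : ℂ)
    {φ K : EuclideanSpace ℝ (Fin d) → ℂ} (hφ : Continuous φ) (hφc : HasCompactSupport φ)
    (hK : ContDiff ℝ 1 K) :
    Differentiable ℝ (fun x => a * ∫ y, φ y * K (x - y)) ∧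
      pdC d j (fun x => a * ∫ y, φ y * K (x - y)) =
        fun x => a * ∫ y, φ y * pdC d j K (x - y) := by
  have hK' : Continuous (fderiv ℝ K) := hK.continuous_fderiv one_ne_zero
  have hKc := hK.continuous
  have hint : ∀ x, Integrable (fun y => φ y • fderiv ℝ K (x - y)) := fun x =>
    (by fun_prop : Continuous fun y => φ y • fderiv ℝ K (x - y)).integrable_of_hasCompactSupport
      (hφc.mono (Function.support_smul_subset_left φ fun y => fderiv ℝ K (x - y)))
  have key : ∀ x, HasFDerivAt (fun x => ∫ y, φ y * K (x - y))
      (∫ y, φ y • fderiv ℝ K (x - y)) x := by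
    intro x
    have hcont : Continuous fun p : EuclideanSpace ℝ (Fin d) × EuclideanSpace ℝ (Fin d) =>
        fderiv ℝ K (p.1 - p.2) := hK'.comp continuous_sub
    obtain ⟨C, hC⟩ := ((isCompact_closedBall x 1).prod hφc).exists_bound_of_continuousOn
      hcont.continuousOn
    refine hasFDerivAt_integral_of_dominated_of_fderiv_le (bound := fun y => ‖φ y‖ * C)
      (F' := fun x y => φ y • fderiv ℝ K (x - y))
      (Metric.closedBall_mem_nhds x one_pos) ?_ ?_ (hint x).aestronglyMeasurable ?_ ?_ ?_
    · exact Filter.Eventually.of_forall fun z =>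
        (by fun_prop : Continuous fun y => φ y * K (z - y)).aestronglyMeasurable
    · exact (by fun_prop : Continuous fun y => φ y * K (x - y)).integrable_of_hasCompactSupport
        hφc.mul_right
    · refine Filter.Eventually.of_forall fun y z hz => ?_
      rw [norm_smul]
      by_cases hy : y ∈ tsupport φ
      · gcongr
        exact hC (z, y) ⟨hz, hy⟩
      · simp [image_eq_zero_of_notMem_tsupport hy]
    · exact (hφ.integrable_of_hasCompactSupport hφc).norm.mul_const C
    · refine Filter.Eventually.of_forall fun y z _ => ?_
      have h : HasFDerivAt (fun z => K (z - y)) (fderiv ℝ K (z - y)) z :=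
        (hasFDerivAt_comp_sub y).2
          ((hK.differentiable one_ne_zero) (z - y)).hasFDerivAt
      exact h.const_mul (φ y)
  refine ⟨fun x => ((key x).const_mul a).differentiableAt, ?_⟩
  funext x
  simp only [pdC, ((key x).const_mul a).fderiv, smul_apply, smul_eq_mul,
    ContinuousLinearMap.integral_apply (hint x)]

/-- Integration by parts, moving one derivative from the kernel onto the test function. -/
theorem integral_mul_pdC_comp_const_sub {d : ℕ} (j : Fin d) (x : EuclideanSpace ℝ (Fin d))
    {φ K : EuclideanSpace ℝ (Fin d) → ℂ} (hφ : ContDiff ℝ 1 φ) (hφc : HasCompactSupport φ)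
    (hK : ContDiff ℝ 1 K) :
    ∫ y, φ y * pdC d j K (x - y) = ∫ y, pdC d j φ y * K (x - y) := by
  have hG : ContDiff ℝ 1 (fun y => K (x - y)) := hK.comp (contDiff_const.sub contDiff_id)
  have hφ0 := hφ.continuous
  have hG0 := hG.continuous
  have hφ1 : Continuous (pdC d j φ) :=
    (hφ.continuous_fderiv one_ne_zero).clm_apply continuous_const
  have hG1 : Continuous (pdC d j (fun y => K (x - y))) :=
    (hG.continuous_fderiv one_ne_zero).clm_apply continuous_const
  have h := integral_mul_fderiv_eq_neg_fderiv_mul_of_integrable (μ := volume)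
    (f := φ) (g := fun y => K (x - y)) (v := EuclideanSpace.single j (1 : ℝ))
    ((hφ1.mul hG0).integrable_of_hasCompactSupport (hφc.fderiv_apply ℝ _).mul_right)
    ((hφ0.mul hG1).integrable_of_hasCompactSupport hφc.mul_right)
    ((hφ0.mul hG0).integrable_of_hasCompactSupport hφc.mul_right)
    (fun y _ => hφ.differentiable one_ne_zero y) (fun y _ => hG.differentiable one_ne_zero y)
  change ∫ y, φ y * pdC d j (fun y => K (x - y)) y = -∫ y, pdC d j φ y * K (x - y) at h
  simpa only [pdC_comp_const_sub, mul_neg, integral_neg, neg_inj] using h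

/-- for s ≠ 0, the fourth x_j-partial of v exists and equals
e^{is} ∫ (∂²f/∂y_j²)(y) (∂²/∂y_j²)p_{is}(x,y) dy. -/
theorem stmt5 (d : ℕ) (hd : 1 ≤ d) (α : ℝ) (hα : α ∈ Set.Ioc (0 : ℝ) 1)
    (f : EuclideanSpace ℝ (Fin d) → ℝ) (hf : ContDiff ℝ 2 f)
    (hsupp : HasCompactSupport f)
    (hHolder : ∀ i j : Fin d, ∃ C : ℝ, ∀ y z : EuclideanSpace ℝ (Fin d),
      |pdR d i (pdR d j f) y - pdR d i (pdR d j f) z| ≤ C * ‖y - z‖ ^ α) :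
    ∀ s : ℝ, s ≠ 0 → ∀ x : EuclideanSpace ℝ (Fin d), ∀ j : Fin d,
      (Differentiable ℝ (vfun d f s) ∧
        Differentiable ℝ (pdC d j (vfun d f s)) ∧
        Differentiable ℝ (pdC d j (pdC d j (vfun d f s))) ∧
        Differentiable ℝ (pdC d j (pdC d j (pdC d j (vfun d f s))))) ∧
      pdC d j (pdC d j (pdC d j (pdC d j (vfun d f s)))) x
        = Complex.exp (Complex.I * (s : ℂ)) *
            ∫ y, ((pdR d j (pdR d j f) y : ℝ) : ℂ) * pdC d j (pdC d j (pk d s x)) y := by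
  intro s hs x j
  set φ : EuclideanSpace ℝ (Fin d) → ℂ := fun y => (f y : ℂ) with hφ
  set K : EuclideanSpace ℝ (Fin d) → ℂ := fun z => pk d s z 0 with hK
  have hφ2 : ContDiff ℝ 2 φ := Complex.ofRealCLM.contDiff.comp hf
  have hφc : HasCompactSupport φ := hsupp.comp_left Complex.ofReal_zero
  have hf1 : ContDiff ℝ 1 (pdR d j f) :=
    (hf.fderiv_right (by norm_num)).clm_apply contDiff_const
  have hφ' : pdC d j φ = fun y => (pdR d j f y : ℂ) :=
    pdC_ofReal j (hf.differentiable (by norm_num))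
  have hφ'' : pdC d j (pdC d j φ) = fun y => (pdR d j (pdR d j f) y : ℂ) := by
    rw [hφ', pdC_ofReal j (hf1.differentiable (by norm_num))]
  have hφ1 : ContDiff ℝ 1 (pdC d j φ) := by
    rw [hφ']
    exact Complex.ofRealCLM.contDiff.comp hf1
  have hφ1c : HasCompactSupport (pdC d j φ) := hφc.fderiv_apply ℝ _
  have hpk : ∀ x, pk d s x = fun y => K (x - y) := fun x => by
    funext y
    simp [hK, pk]
  have hv : vfun d f s =
      fun x => Complex.exp (Complex.I * (s : ℂ)) * ∫ y, φ y * K (x - y) := by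
    funext x
    simp only [vfun, hpk, hφ]
  have K0 : ContDiff ℝ ∞ K := contDiff_pk_left d s
  have K1 := K0.pdC j
  have K2 := K1.pdC j
  have K3 := K2.pdC j
  have hle : (1 : WithTop ℕ∞) ≤ ∞ := by exact_mod_cast le_top
  have D0 := differentiable_convolution_and_pdC_eq j (Complex.exp (Complex.I * (s : ℂ)))
    hφ2.continuous hφc (K0.of_le hle)
  have D1 := differentiable_convolution_and_pdC_eq j (Complex.exp (Complex.I * (s : ℂ)))
    hφ2.continuous hφc (K1.of_le hle)
  have D2 := differentiable_convolution_and_pdC_eq j (Complex.exp (Complex.I * (s : ℂ)))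
    hφ2.continuous hφc (K2.of_le hle)
  have D3 := differentiable_convolution_and_pdC_eq j (Complex.exp (Complex.I * (s : ℂ)))
    hφ2.continuous hφc (K3.of_le hle)
  rw [hv, D0.2, D1.2, D2.2, D3.2]
  refine ⟨⟨D0.1, D1.1, D2.1, D3.1⟩, ?_⟩
  have hpk2 : pdC d j (pdC d j (pk d s x)) = fun y => pdC d j (pdC d j K) (x - y) := by
    rw [hpk, pdC_comp_const_sub j x]
    funext y
    rw [pdC_neg, pdC_comp_const_sub j x, neg_neg]
  rw [hpk2]
  simp only
  rw [integral_mul_pdC_comp_const_sub j x (hφ2.of_le (by norm_num)) hφc (K3.of_le hle),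
    integral_mul_pdC_comp_const_sub j x hφ1 hφ1c (K2.of_le hle), hφ'']

end
end
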